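/- Let 𝔽 be a finite field, and work in the ring R± = 𝔽[T, T^{-1}] of Laurent polynomials over 𝔽. Let d₁ ≥ d₂ ≥ d₃ be integers and a ∈ 𝔽 with a ≠ 0. Then there exist matrices A ∈ GL₃(R−) and B ∈ GL₃(R+) such that A · M · B = D, where M is the 3×3 upper-triangular matrix with rows (T^{d₁+1}, a·T^{d₁}, 0), (0, T^{d₂}, 0), (0, 0, T^{d₃+1}), and D is the diagonal matrix diag(T^{d₁}, T^{d₂+1}, T^{d₃+1}). -/

import Mathlib

open Matrix LaurentPolynomial

/-- `R⁺ = 𝔽[T]`: the subring of Laurent polynomials supported in nonnegative powers. -/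
noncomputable def laurentPlus (𝔽 : Type*) [Field 𝔽] : Subring (LaurentPolynomial 𝔽) :=
  (Polynomial.aeval (LaurentPolynomial.T 1) : Polynomial 𝔽 →ₐ[𝔽] LaurentPolynomial 𝔽).range.toSubring

/-- `R⁻ = 𝔽[T⁻¹]`: the subring of Laurent polynomials supported in nonpositive powers. -/
noncomputable def laurentMinus (𝔽 : Type*) [Field 𝔽] : Subring (LaurentPolynomial 𝔽) :=
  (Polynomial.aeval (LaurentPolynomial.T (-1)) : Polynomial 𝔽 →ₐ[𝔽] LaurentPolynomial 𝔽).range.toSubring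

theorem laurentPlus_C_mem {𝔽 : Type*} [Field 𝔽] (a : 𝔽) : (C a : LaurentPolynomial 𝔽) ∈ laurentPlus 𝔽 :=
  ⟨Polynomial.C a, by simp [LaurentPolynomial.algebraMap_apply]⟩

theorem laurentPlus_T_mem {𝔽 : Type*} [Field 𝔽] : (T 1 : LaurentPolynomial 𝔽) ∈ laurentPlus 𝔽 :=
  ⟨Polynomial.X, by simp⟩

theorem laurentMinus_mem {𝔽 : Type*} [Field 𝔽] (a : 𝔽) (d : ℤ) (hd : d ≤ 0) :
    (C a * T d : LaurentPolynomial 𝔽) ∈ laurentMinus 𝔽 := by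
  obtain ⟨n, rfl⟩ : ∃ n : ℕ, d = -(n : ℤ) := ⟨d.natAbs, by omega⟩
  exact ⟨Polynomial.C a * Polynomial.X ^ n, by
    simp [LaurentPolynomial.algebraMap_apply, LaurentPolynomial.T_pow]⟩

/-- For `d₁ ≥ d₂ ≥ d₃` and `a ≠ 0`, the upper-triangular matrix with rows
`(T^{d₁+1}, a·T^{d₁}, 0)`, `(0, T^{d₂}, 0)`, `(0, 0, T^{d₃+1})` can be reduced to
`diag(T^{d₁}, T^{d₂+1}, T^{d₃+1})` by left multiplication by an element of
`GL₃(𝔽[T⁻¹])` and right multiplication by an element of `GL₃(𝔽[T])`. -/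
theorem doubleCoset_reduction_rank_three_last (𝔽 : Type*) [Field 𝔽] [Fintype 𝔽]
    (d₁ d₂ d₃ : ℤ) (hd₁ : d₂ ≤ d₁) (hd₂ : d₃ ≤ d₂) (a : 𝔽) (ha : a ≠ 0) :
    ∃ (A : GL (Fin 3) (laurentMinus 𝔽)) (B : GL (Fin 3) (laurentPlus 𝔽)),
      ((Matrix.GeneralLinearGroup.map (laurentMinus 𝔽).subtype A :
          GL (Fin 3) (LaurentPolynomial 𝔽)) : Matrix (Fin 3) (Fin 3) (LaurentPolynomial 𝔽)) *
        Matrix.of ![![T (d₁ + 1), C a * T d₁, 0],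
                    ![0, T d₂, 0],
                    ![0, 0, T (d₃ + 1)]] *
        ((Matrix.GeneralLinearGroup.map (laurentPlus 𝔽).subtype B :
          GL (Fin 3) (LaurentPolynomial 𝔽)) : Matrix (Fin 3) (Fin 3) (LaurentPolynomial 𝔽))
      = Matrix.diagonal ![T d₁, T (d₂ + 1), T (d₃ + 1)] := by
  let p : laurentMinus 𝔽 := ⟨C (-a⁻¹) * T (d₂ - d₁), laurentMinus_mem _ _ (by omega)⟩
  let u : laurentPlus 𝔽 := ⟨C (-a), laurentPlus_C_mem _⟩
  let v : laurentPlus 𝔽 := ⟨C (a⁻¹), laurentPlus_C_mem _⟩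
  let t : laurentPlus 𝔽 := ⟨T 1, laurentPlus_T_mem⟩
  have hC : (C a : LaurentPolynomial 𝔽) * C a⁻¹ = 1 := by
    rw [← map_mul, mul_inv_cancel₀ ha, map_one]
  have huv : u * v = -1 := by
    apply Subtype.ext
    simp [u, v, hC]
  refine ⟨Matrix.GeneralLinearGroup.mk'' !![1, 0, 0; p, 1, 0; 0, 0, 1]
      (by simp [Matrix.det_fin_three]),
    Matrix.GeneralLinearGroup.mk'' !![0, u, 0; v, t, 0; 0, 0, 1]
      (by simp [Matrix.det_fin_three, huv]), ?_⟩
  have h1 : (T (d₁ + 1) : LaurentPolynomial 𝔽) = T d₁ * T 1 := T_add _ _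
  have h2 : (T (d₂ + 1) : LaurentPolynomial 𝔽) = T d₂ * T 1 := T_add _ _
  have h3 : (T (d₂ - d₁) : LaurentPolynomial 𝔽) * T d₁ = T d₂ := by
    rw [← T_add]; congr 1; omega
  have hA : (!![1, 0, 0; p, 1, 0; 0, 0, 1] : Matrix _ _ _).map (laurentMinus 𝔽).subtype
      = !![1, 0, 0; C (-a⁻¹) * T (d₂ - d₁), 1, 0; 0, 0, 1] := by
    ext1 i j
    fin_cases i <;> fin_cases j <;> rfl
  have hB : (!![0, u, 0; v, t, 0; 0, 0, 1] : Matrix _ _ _).map (laurentPlus 𝔽).subtype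
      = !![0, C (-a), 0; C a⁻¹, T 1, 0; 0, 0, 1] := by
    ext1 i j
    fin_cases i <;> fin_cases j <;> rfl
  change (!![1, 0, 0; p, 1, 0; 0, 0, 1] : Matrix _ _ _).map (laurentMinus 𝔽).subtype * _ *
    (!![0, u, 0; v, t, 0; 0, 0, 1] : Matrix _ _ _).map (laurentPlus 𝔽).subtype = _
  rw [hA, hB, h1, h2, map_neg, map_neg]
  clear_value p u v t
  clear hA hB huv h1 h2
  generalize (T (d₃ + 1) : LaurentPolynomial 𝔽) = w3
  generalize (T (d₂ - d₁) : LaurentPolynomial 𝔽) = w at *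
  generalize (T d₁ : LaurentPolynomial 𝔽) = w1 at *
  generalize (T d₂ : LaurentPolynomial 𝔽) = w2 at *
  generalize (T 1 : LaurentPolynomial 𝔽) = x at *
  generalize (C a : LaurentPolynomial 𝔽) = c at *
  generalize (C a⁻¹ : LaurentPolynomial 𝔽) = c' at *
  subst h3
  ext1 i j
  fin_cases i <;> fin_cases j <;>
    simp [Matrix.mul_apply, Fin.sum_univ_three] <;> grind
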